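/- Let ω₁, ω₂ ∈ ℂ ∖ {0} with Im(ω₁/ω₂) > 0 (so that |e^{2πiω₁/ω₂}| < 1 and |e^{−2πiω₂/ω₁}| < 1). Then for every u ∈ ℂ, θ(e^{−2πiu/ω₁}; e^{−2πiω₂/ω₁}) = e^{πi B_{2,2}(u|ω₁,ω₂)} · θ(e^{2πiu/ω₂}; e^{2πiω₁/ω₂}), where B_{2,2}(u|ω₁,ω₂) = (1/(ω₁ω₂))·(u² − (ω₁+ω₂)u + (ω₁²+ω₂²)/6 + ω₁ω₂/2) is the second Bernoulli polynomial. -/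

import Mathlib

/-- The infinite q-Pochhammer symbol `(x;p)_∞ = ∏_{j≥0} (1 - x p^j)`. -/
noncomputable def pochInf (x p : ℂ) : ℂ := ∏' j : ℕ, (1 - x * p ^ j)

/-- The theta function `θ(x;p) = (x;p)_∞ (p x⁻¹;p)_∞`. -/
noncomputable def theta (x p : ℂ) : ℂ := pochInf x p * pochInf (p * x⁻¹) p

/-- The second Bernoulli polynomial `B_{2,2}(u|ω₁,ω₂)`. -/
noncomputable def B22 (u ω₁ ω₂ : ℂ) : ℂ :=
  (ω₁ * ω₂)⁻¹ * (u ^ 2 - (ω₁ + ω₂) * u + (ω₁ ^ 2 + ω₂ ^ 2) / 6 + ω₁ * ω₂ / 2)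

open Complex Filter Topology

namespace ThetaAux

noncomputable def gb (p : ℂ) : ℕ → ℕ → ℂ
  | _, 0 => 1
  | 0, _ + 1 => 0
  | M + 1, k + 1 => gb p M k + p ^ (k + 1) * gb p M (k + 1)

noncomputable def fac (p : ℂ) (n : ℕ) : ℂ := ∏ j ∈ Finset.range n, (1 - p ^ (j + 1))

lemma gb_zero_right (p : ℂ) (M : ℕ) : gb p M 0 = 1 := by cases M <;> rfl

lemma gb_lt (p : ℂ) (M k : ℕ) (h : M < k) : gb p M k = 0 := by
  induction M generalizing k with
  | zero => cases k with
    | zero => omega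
    | succ k => rfl
  | succ M ih => cases k with
    | zero => omega
    | succ k => simp [gb, ih k (by omega), ih (k + 1) (by omega)]

lemma fac_succ (p : ℂ) (n : ℕ) : fac p (n + 1) = fac p n * (1 - p ^ (n + 1)) := by
  simp [fac, Finset.prod_range_succ]

lemma gb_fac (p : ℂ) (n : ℕ) : ∀ a b : ℕ, a + b = n →
    gb p (a + b) a * fac p a * fac p b = fac p (a + b) := by
  induction n with
  | zero =>
    intro a b h
    obtain ⟨rfl, rfl⟩ : a = 0 ∧ b = 0 := by omega
    simp [gb, fac]
  | succ n ih =>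
    intro a b h
    cases a with
    | zero => simp [gb_zero_right, fac]
    | succ a =>
      have h1 := ih a b (by omega)
      rw [show a + 1 + b = (a + b) + 1 by ring, gb, fac_succ p (a + b), fac_succ p a]
      cases b with
      | zero =>
        rw [gb_lt p (a + 0) (a + 1) (by omega)]
        simp only [add_zero] at h1 ⊢
        linear_combination (1 - p ^ (a + 1)) * h1
      | succ b =>
        have h2 := ih (a + 1) b (by omega)
        rw [show a + 1 + b = a + (b + 1) by ring, fac_succ p a] at h2
        rw [fac_succ p b] at h1 ⊢
        linear_combination (1 - p ^ (a + 1)) * h1 + p ^ (a + 1) * (1 - p ^ (b + 1)) * h2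

lemma gauss (p : ℂ) (M : ℕ) : ∀ y : ℂ, ∏ j ∈ Finset.range M, (1 - y * p ^ j) =
    ∑ k ∈ Finset.range (M + 1), (-1) ^ k * p ^ (k.choose 2) * gb p M k * y ^ k := by
  induction M with
  | zero => intro y; simp [gb]
  | succ M ih =>
    intro y
    rw [Finset.prod_range_succ']
    have h1 : ∀ j, 1 - y * p ^ (j + 1) = 1 - (y * p) * p ^ j := by intro j; ring
    simp only [h1, ih, pow_zero, mul_one]
    have hs : ∀ k, (-1 : ℂ) ^ (k + 1) * p ^ ((k + 1).choose 2) * gb p (M + 1) (k + 1) * y ^ (k + 1)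
        = (-1) ^ (k + 1) * p ^ ((k + 1).choose 2) * gb p M (k + 1) * (y * p) ^ (k + 1)
          - y * ((-1) ^ k * p ^ (k.choose 2) * gb p M k * (y * p) ^ k) := by
      intro k
      have : (k + 1).choose 2 = k + k.choose 2 := by
        rw [Nat.choose_succ_succ' k 1, Nat.choose_one_right]
      rw [gb, this]
      ring
    rw [Finset.sum_range_succ' _ (M + 1)]
    simp only [hs, Finset.sum_sub_distrib, ← Finset.mul_sum]
    have hl : ∑ k ∈ Finset.range (M + 1),
        (-1 : ℂ) ^ (k + 1) * p ^ ((k + 1).choose 2) * gb p M (k + 1) * (y * p) ^ (k + 1) =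
        ∑ k ∈ Finset.range M,
        (-1 : ℂ) ^ (k + 1) * p ^ ((k + 1).choose 2) * gb p M (k + 1) * (y * p) ^ (k + 1) := by
      rw [Finset.sum_range_succ _ M, gb_lt p M (M + 1) (by omega)]; simp
    rw [hl]
    conv_lhs => rw [mul_sub, mul_one]; enter [1]; rw [Finset.sum_range_succ' _ M]
    simp only [gb_zero_right]
    simp
    ring

/-- finite triple product -/
lemma finite_triple (p x : ℂ) (hp : p ≠ 0) (hx : x ≠ 0) (N : ℕ) :
    (∏ j ∈ Finset.range N, (1 - x * p ^ j)) * ∏ j ∈ Finset.range N, (1 - p * x⁻¹ * p ^ j) =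
    ∑ k ∈ Finset.range (2 * N + 1), (-1) ^ k * p ^ (k.choose 2) * gb p (2 * N) k *
      (x * (p ^ N)⁻¹) ^ k * ((-x⁻¹) ^ N * p ^ ((N + 1).choose 2)) := by
  rw [← Finset.sum_mul, ← gauss, two_mul, Finset.prod_range_add]
  have h1 : ∏ j ∈ Finset.range N, (1 - x * (p ^ N)⁻¹ * p ^ (N + j)) =
      ∏ j ∈ Finset.range N, (1 - x * p ^ j) := by
    refine Finset.prod_congr rfl fun j _ => ?_
    rw [pow_add]; field_simp
  have h2 : (∏ j ∈ Finset.range N, (1 - x * (p ^ N)⁻¹ * p ^ j)) *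
      ((-x⁻¹) ^ N * p ^ ((N + 1).choose 2)) =
      ∏ j ∈ Finset.range N, (1 - p * x⁻¹ * p ^ j) := by
    rw [← Finset.prod_range_reflect (fun j => (1 - p * x⁻¹ * p ^ j))]
    have h3 : (-x⁻¹) ^ N * p ^ ((N + 1).choose 2) =
        ∏ j ∈ Finset.range N, (-x⁻¹ * p ^ (N - j)) := by
      rw [Finset.prod_mul_distrib, Finset.prod_const, Finset.card_range,
        Finset.prod_pow_eq_pow_sum]
      congr 2
      clear * -
      induction N with
      | zero => simp
      | succ N ih =>
        rw [Finset.sum_range_succ', Nat.choose_succ_succ' (N + 1) 1, Nat.choose_one_right]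
        simp only [Nat.add_sub_add_right, Nat.reduceAdd]
        omega
    rw [h3, ← Finset.prod_mul_distrib]
    refine Finset.prod_congr rfl fun j hj => ?_
    have hj := Finset.mem_range.mp hj
    obtain ⟨m, rfl⟩ : ∃ m, N = j + 1 + m := ⟨N - (j + 1), by omega⟩
    rw [show j + 1 + m - j = m + 1 by omega, show j + 1 + m - 1 - j = m by omega]
    field_simp
    ring
  rw [h1, ← h2]
  ring

lemma multipliable_poch (x p : ℂ) (hp : ‖p‖ < 1) : Multipliable fun j : ℕ => 1 - x * p ^ j := by
  have := multipliable_one_add_of_summable (f := fun j : ℕ => -(x * p ^ j)) (by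
    simpa using (summable_geometric_of_lt_one (norm_nonneg _) hp).mul_left ‖x‖)
  simpa [sub_eq_add_neg] using this

lemma tendsto_poch (x p : ℂ) (hp : ‖p‖ < 1) :
    Tendsto (fun N => ∏ j ∈ Finset.range N, (1 - x * p ^ j)) atTop (𝓝 (pochInf x p)) :=
  (multipliable_poch x p hp).hasProd.tendsto_prod_nat

lemma tendsto_fac (p : ℂ) (hp : ‖p‖ < 1) : Tendsto (fac p) atTop (𝓝 (pochInf p p)) := by
  have := tendsto_poch p p hp
  refine this.congr fun N => ?_
  simp [fac, pow_succ']

lemma one_sub_ne (p : ℂ) (hp : ‖p‖ < 1) (n : ℕ) : 1 - p ^ (n + 1) ≠ 0 := by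
  intro h
  have h1 : p ^ (n + 1) = 1 := (sub_eq_zero.mp h).symm
  have h2 : ‖p‖ ^ (n + 1) < 1 := pow_lt_one₀ (norm_nonneg _) hp (by omega)
  rw [← norm_pow, h1] at h2
  simp at h2

lemma fac_ne (p : ℂ) (hp : ‖p‖ < 1) (n : ℕ) : fac p n ≠ 0 :=
  Finset.prod_ne_zero_iff.mpr fun j _ => one_sub_ne p hp j

lemma pochInf_self_ne (p : ℂ) (hp : ‖p‖ < 1) : pochInf p p ≠ 0 := by
  have := tprod_one_add_ne_zero_of_summable (f := fun j : ℕ => -(p * p ^ j)) (by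
    intro i
    have := one_sub_ne p hp i
    rwa [pow_succ', sub_eq_add_neg] at this) (by
    simpa using (summable_geometric_of_lt_one (norm_nonneg _) hp).mul_left ‖p‖)
  simpa [pochInf, sub_eq_add_neg] using this

lemma gb_eq (p : ℂ) (hp : ‖p‖ < 1) (a b : ℕ) :
    gb p (a + b) a = fac p (a + b) * (fac p a)⁻¹ * (fac p b)⁻¹ := by
  have h := gb_fac p _ a b rfl
  have h1 := fac_ne p hp a
  have h2 := fac_ne p hp b
  field_simp
  exact h

lemma gb_bound (p : ℂ) (hp : ‖p‖ < 1) : ∃ C : ℝ, ∀ M k, ‖gb p M k‖ ≤ C := by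
  obtain ⟨A, hA⟩ := (tendsto_fac p hp).norm.bddAbove_range
  obtain ⟨B, hB⟩ := ((tendsto_fac p hp).inv₀ (pochInf_self_ne p hp)).norm.bddAbove_range
  have hA' : ∀ n, ‖fac p n‖ ≤ A := fun n => hA ⟨n, rfl⟩
  have hB' : ∀ n, ‖(fac p n)⁻¹‖ ≤ B := fun n => hB ⟨n, rfl⟩
  have hA0 : 0 ≤ A := (norm_nonneg _).trans (hA' 0)
  have hB0 : 0 ≤ B := (norm_nonneg _).trans (hB' 0)
  refine ⟨A * B * B, fun M k => ?_⟩
  rcases lt_or_ge M k with h | h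
  · rw [gb_lt p M k h, norm_zero]; positivity
  · obtain ⟨b, rfl⟩ := Nat.exists_eq_add_of_le h
    rw [gb_eq p hp, norm_mul, norm_mul]
    gcongr
    · exact hA' _
    · exact hB' _
    · exact hB' _

lemma gb_tendsto (p : ℂ) (hp : ‖p‖ < 1) (n : ℤ) :
    Tendsto (fun N : ℕ => gb p (2 * N) (N + n).toNat) atTop (𝓝 (pochInf p p)⁻¹) := by
  have h0 := pochInf_self_ne p hp
  have t := tendsto_fac p hp
  have ta : Tendsto (fun N : ℕ => (N + n).toNat) atTop atTop :=
    tendsto_atTop.mpr fun b => by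
      filter_upwards [eventually_ge_atTop (b + n.natAbs)] with N hN; omega
  have tb : Tendsto (fun N : ℕ => (N - n).toNat) atTop atTop :=
    tendsto_atTop.mpr fun b => by
      filter_upwards [eventually_ge_atTop (b + n.natAbs)] with N hN; omega
  have tc : Tendsto (fun N : ℕ => 2 * N) atTop atTop :=
    tendsto_atTop.mpr fun b => by
      filter_upwards [eventually_ge_atTop b] with N hN; omega
  have := ((t.comp tc).mul ((t.comp ta).inv₀ h0)).mul ((t.comp tb).inv₀ h0)
  rw [mul_inv_cancel₀ h0, one_mul] at this
  refine this.congr' ?_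
  filter_upwards [eventually_ge_atTop n.natAbs] with N hN
  have e : 2 * N = (N + n).toNat + (N - n).toNat := by omega
  simp only [Function.comp]
  rw [e, gb_eq p hp]

lemma term_eq (z τ : ℂ) (k N : ℕ) :
    (-1) ^ k * cexp (2 * Real.pi * I * τ) ^ (k.choose 2) *
      (cexp (2 * Real.pi * I * z) * (cexp (2 * Real.pi * I * τ) ^ N)⁻¹) ^ k *
      ((-(cexp (2 * Real.pi * I * z))⁻¹) ^ N * cexp (2 * Real.pi * I * τ) ^ ((N + 1).choose 2)) =
    jacobiTheta₂_term ((k : ℤ) - N) (z + 1 / 2 - τ / 2) τ := by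
  have e1 : (-1 : ℂ) ^ k = cexp (k * (Real.pi * I)) := by rw [exp_nat_mul, exp_pi_mul_I]
  have e2 : -(cexp (2 * Real.pi * I * z))⁻¹ = cexp (-(Real.pi * I) - 2 * Real.pi * I * z) := by
    rw [exp_sub, exp_neg, exp_pi_mul_I]; field_simp
  rw [e1, e2, jacobiTheta₂_term]
  simp only [← exp_nat_mul, ← exp_neg, ← exp_add]
  congr 1
  rw [Nat.cast_choose_two, Nat.cast_choose_two]
  push_cast
  ring

lemma norm_q_lt (τ : ℂ) (hτ : 0 < τ.im) : ‖cexp (2 * Real.pi * I * τ)‖ < 1 :=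
  UpperHalfPlane.norm_exp_two_pi_I_lt_one ⟨τ, hτ⟩

lemma triple (z τ : ℂ) (hτ : 0 < τ.im) :
    theta (cexp (2 * Real.pi * I * z)) (cexp (2 * Real.pi * I * τ)) *
      pochInf (cexp (2 * Real.pi * I * τ)) (cexp (2 * Real.pi * I * τ)) =
    jacobiTheta₂ (z + 1 / 2 - τ / 2) τ := by
  set p := cexp (2 * Real.pi * I * τ) with hpdef
  set x := cexp (2 * Real.pi * I * z) with hxdef
  have hp : ‖p‖ < 1 := norm_q_lt τ hτ
  have h0 := pochInf_self_ne p hp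
  let t : ℤ → ℂ := fun n => jacobiTheta₂_term n (z + 1 / 2 - τ / 2) τ
  have ht : Summable t := (summable_jacobiTheta₂_term_iff _ _).mpr hτ
  let F : ℕ → ℤ → ℂ := fun N n => if n < -N then 0 else gb p (2 * N) (N + n).toNat * t n
  have hF : ∀ N : ℕ, ∑' n, F N n =
      (∏ j ∈ Finset.range N, (1 - x * p ^ j)) * ∏ j ∈ Finset.range N, (1 - p * x⁻¹ * p ^ j) := by
    intro N
    rw [finite_triple p x (exp_ne_zero _) (exp_ne_zero _)]
    rw [tsum_eq_sum (s := (Finset.range (2 * N + 1)).image (fun k : ℕ => (k : ℤ) - N))]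
    · rw [Finset.sum_image (by intro a _ b _ h; simpa using h)]
      refine Finset.sum_congr rfl fun k hk => ?_
      have e : ((N : ℤ) + ((k : ℤ) - N)).toNat = k := by omega
      simp only [F]
      rw [if_neg (by omega), e]
      simp only [t]
      rw [← term_eq]
      ring
    · intro n hn
      simp only [F]
      split_ifs with h
      · rfl
      · rw [gb_lt, zero_mul]
        by_contra h'
        apply hn
        rw [Finset.mem_image]
        exact ⟨(N + n).toNat, by rw [Finset.mem_range]; omega, by omega⟩
  have l1 : Tendsto (fun N => ∑' n, F N n) atTop (𝓝 (theta x p)) := by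
    simp only [hF]
    exact (tendsto_poch x p hp).mul (tendsto_poch _ p hp)
  obtain ⟨C, hC⟩ := gb_bound p hp
  have hC0 : 0 ≤ C := (norm_nonneg _).trans (hC 0 0)
  have l2 : Tendsto (fun N => ∑' n, F N n) atTop (𝓝 (∑' n, (pochInf p p)⁻¹ * t n)) := by
    refine tendsto_tsum_of_dominated_convergence (bound := fun n => C * ‖t n‖)
      (ht.norm.mul_left C) ?_ (Eventually.of_forall ?_)
    · intro n
      refine ((gb_tendsto p hp n).mul_const (t n)).congr' ?_
      filter_upwards [eventually_ge_atTop n.natAbs] with N hN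
      simp only [F]
      rw [if_neg (by omega)]
    · intro N n
      simp only [F]
      split_ifs
      · rw [norm_zero]; positivity
      · rw [norm_mul]; gcongr; exact hC _ _
  have := tendsto_nhds_unique l1 l2
  rw [this, tsum_mul_left]
  simp only [t]
  rw [← jacobiTheta₂]
  field_simp

lemma eta_eq (τ : ℂ) : ModularForm.eta τ = cexp (Real.pi * I * τ / 12) *
    pochInf (cexp (2 * Real.pi * I * τ)) (cexp (2 * Real.pi * I * τ)) := by
  rw [ModularForm.eta, pochInf]
  congr 1
  · rw [Function.Periodic.qParam]; congr 1; push_cast; ring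
  · refine tprod_congr fun n => ?_
    rw [ModularForm.eta_q_eq_pow, pow_succ']

lemma sqrt_rel (τ : ℂ) (hτ : 0 < τ.im) :
    (Complex.sqrt I)⁻¹ * Complex.sqrt τ = (-I * τ) ^ (1 / 2 : ℂ) := by
  have hτ0 : τ ≠ 0 := by rintro rfl; simp at hτ
  have hlog : Complex.log (-I * τ) = Complex.log (-I) + Complex.log τ := by
    apply Complex.log_mul (by simp) hτ0
    rw [Complex.arg_neg_I]
    have h1 := Complex.arg_nonneg_iff.mpr hτ.le
    have h2 := Complex.arg_le_pi τ
    constructor <;> linarith [Real.pi_pos]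
  rw [Complex.sqrt, Complex.sqrt, cpow_def_of_ne_zero I_ne_zero, cpow_def_of_ne_zero hτ0,
    ← exp_neg, ← exp_add, cpow_def_of_ne_zero (by simp [hτ0]), hlog, log_neg_I, log_I]
  congr 1
  ring

lemma main (z τ : ℂ) (hτ : 0 < τ.im) :
    theta (cexp (2 * Real.pi * I * (-z / τ))) (cexp (2 * Real.pi * I * (-1 / τ))) =
    cexp (Real.pi * I * (z ^ 2 / τ - z - z / τ + τ / 6 + 1 / (6 * τ) + 1 / 2)) *
    theta (cexp (2 * Real.pi * I * z)) (cexp (2 * Real.pi * I * τ)) := by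
  have hτ0 : τ ≠ 0 := by rintro rfl; simp at hτ
  have hτ' : 0 < (-1 / τ).im := by
    rw [div_eq_mul_inv, neg_one_mul, neg_im, inv_im, neg_div, neg_neg]
    exact div_pos hτ (normSq_pos.mpr hτ0)
  have T := triple z τ hτ
  have T' := triple (-z / τ) (-1 / τ) hτ'
  have E : ModularForm.eta (-1 / τ) = (Complex.sqrt I)⁻¹ * (Complex.sqrt τ * ModularForm.eta τ) := by
    simpa using ModularForm.eta_comp_eq_csqrt_I_inv hτ
  rw [← mul_assoc, sqrt_rel τ hτ, eta_eq, eta_eq] at E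
  have hφ := pochInf_self_ne _ (norm_q_lt τ hτ)
  have hφ' := pochInf_self_ne _ (norm_q_lt _ hτ')
  have FE := jacobiTheta₂_functional_equation (z + 1 / 2 - τ / 2) τ
  have Q := jacobiTheta₂_add_left' (-z / τ + 1 / 2 - (-1 / τ) / 2) (-1 / τ)
  rw [← jacobiTheta₂_neg_left, show -(-z / τ + 1 / 2 - (-1 / τ) / 2 + -1 / τ) =
    (z + 1 / 2 - τ / 2) / τ by field_simp; ring] at Q
  rw [Q, ← T, ← T'] at FE
  have hs : (-I * τ) ^ (1 / 2 : ℂ) ≠ 0 := by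
    rw [cpow_def_of_ne_zero (by simp [hτ0])]; exact exp_ne_zero _
  generalize (-I * τ) ^ (1 / 2 : ℂ) = s at *
  generalize theta (cexp (2 * Real.pi * I * (-z / τ))) (cexp (2 * Real.pi * I * (-1 / τ))) = θ' at *
  generalize theta (cexp (2 * Real.pi * I * z)) (cexp (2 * Real.pi * I * τ)) = θ at *
  generalize pochInf (cexp (2 * Real.pi * I * τ)) (cexp (2 * Real.pi * I * τ)) = φ at *
  generalize pochInf (cexp (2 * Real.pi * I * (-1 / τ))) (cexp (2 * Real.pi * I * (-1 / τ))) = φ'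
    at *
  have X : cexp (Real.pi * I * (z ^ 2 / τ - z - z / τ + τ / 6 + 1 / (6 * τ) + 1 / 2)) *
      cexp (-Real.pi * I * (z + 1 / 2 - τ / 2) ^ 2 / τ) *
      cexp (-Real.pi * I * (-1 / τ + 2 * (-z / τ + 1 / 2 - (-1 / τ) / 2))) *
      cexp (Real.pi * I * τ / 12) = cexp (Real.pi * I * (-1 / τ) / 12) := by
    simp only [← exp_add]
    congr 1
    field_simp
    ring
  generalize cexp (Real.pi * I * (z ^ 2 / τ - z - z / τ + τ / 6 + 1 / (6 * τ) + 1 / 2)) = A at *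
  generalize cexp (-Real.pi * I * (z + 1 / 2 - τ / 2) ^ 2 / τ) = B at *
  generalize cexp (-Real.pi * I * (-1 / τ + 2 * (-z / τ + 1 / 2 - (-1 / τ) / 2))) = D at *
  have hG : cexp (Real.pi * I * τ / 12) ≠ 0 := exp_ne_zero _
  generalize cexp (Real.pi * I * τ / 12) = G at *
  generalize cexp (Real.pi * I * (-1 / τ) / 12) = H at *
  field_simp at FE
  apply mul_right_cancel₀ (mul_ne_zero (mul_ne_zero hφ hs) hG)
  linear_combination (-A * G) * FE - θ' * E - θ' * φ' * X

end ThetaAux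

/-- The modular transformation law for the theta function:
`θ(e^{-2πiu/ω₁}; e^{-2πiω₂/ω₁}) = e^{πi B_{2,2}(u|ω₁,ω₂)} θ(e^{2πiu/ω₂}; e^{2πiω₁/ω₂})`. -/
theorem theta_modular_transformation (ω₁ ω₂ : ℂ) (hω₁ : ω₁ ≠ 0) (hω₂ : ω₂ ≠ 0)
    (him : 0 < (ω₁ / ω₂).im) (u : ℂ) :
    theta (Complex.exp (-(2 * (Real.pi : ℂ) * Complex.I) * u / ω₁))
        (Complex.exp (-(2 * (Real.pi : ℂ) * Complex.I) * ω₂ / ω₁)) =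
      Complex.exp ((Real.pi : ℂ) * Complex.I * B22 u ω₁ ω₂) *
        theta (Complex.exp (2 * (Real.pi : ℂ) * Complex.I * u / ω₂))
          (Complex.exp (2 * (Real.pi : ℂ) * Complex.I * ω₁ / ω₂)) := by
  have h := ThetaAux.main (u / ω₂) (ω₁ / ω₂) him
  convert h using 3
  · field_simp
  · field_simp
  · rw [B22]; field_simp; ring
  · field_simp
  · field_simp
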